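/- Let X be a weighted projective line of tubular type and E, F nonzero vector bundles with μ(E) < μ(F). Then Hom(E, τⁱF) ≠ 0 for some i ∈ ℤ. If moreover E or F is a non-exceptional indecomposable bundle, then Hom(E, F) ≠ 0. -/

import Mathlib

open CategoryTheory CategoryTheory.Limits

universe v u

variable (k : Type*) [Field k]

section Defs

variable {A : Type u} [Category.{v} A] [Abelian A] [Linear k A]

/-- `Ext¹(X, Y) = 0`, expressed by the splitting of every short exact sequence
`0 → Y → M → X → 0`. -/
def Ext1IsZero (X Y : A) : Prop :=
  ∀ (M : A) (i : Y ⟶ M) (p : M ⟶ X) (w : i ≫ p = 0), Mono i → Epi p →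
    (ShortComplex.mk i p w).Exact → ∃ r : M ⟶ Y, i ≫ r = 𝟙 Y

/-- An object has finite length if its subobject lattice satisfies both chain conditions. -/
def FiniteLengthObj (X : A) : Prop :=
  WellFoundedGT (Subobject X) ∧ WellFoundedLT (Subobject X)

/-- A vector bundle is a torsion-free sheaf: every finite length subobject is zero. -/
def IsBundle (X : A) : Prop :=
  ∀ (Y : A) (f : Y ⟶ X), Mono f → FiniteLengthObj Y → IsZero Y

end Defs

/-- The `n`-fold composition of an endofunctor. -/
def fpow {A : Type u} [Category.{v} A] (F : A ⥤ A) : ℕ → A ⥤ A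
  | 0 => 𝟭 A
  | n + 1 => fpow F n ⋙ F

/-- The `i`-th power (for `i : ℤ`) of an autoequivalence. -/
def epow {A : Type u} [Category.{v} A] (F : A ≌ A) (i : ℤ) : A ⥤ A :=
  if 0 ≤ i then fpow F.functor i.toNat else fpow F.inverse (-i).toNat

/-- Data exhibiting a Hom-finite `k`-linear abelian category `A` as `coh X` for a weighted
projective line `X` of tubular type (genus 1): rank and degree, the Auslander–Reiten
translation `τ` of period `p` preserving slopes, Serre duality
`Ext¹(X, Y) ≅ D Hom(Y, τ X)`, the Riemann–Roch theorem in averaged form, semistability of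
all indecomposable bundles, and the quasi-top filtration of a non-exceptional indecomposable
bundle by the `τ`-orbit of its quasi-top. -/
structure TubularWPLData (A : Type u) [Category.{v} A] [Abelian A] [Linear k A] where
  homFinite : ∀ X Y : A, FiniteDimensional k (X ⟶ Y)
  tau : A ≌ A
  p : ℕ
  hp : 0 < p
  tau_period : Nonempty (fpow tau.functor p ≅ 𝟭 A)
  rk : A → ℤ
  deg : A → ℤ
  rk_nonneg : ∀ X : A, 0 ≤ rk X
  rk_zero_iff_torsion : ∀ X : A, rk X = 0 ↔ FiniteLengthObj X
  rk_pos_of_bundle : ∀ X : A, IsBundle X → ¬ IsZero X → 0 < rk X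
  rk_tau : ∀ X : A, rk (tau.functor.obj X) = rk X
  deg_tau : ∀ X : A, deg (tau.functor.obj X) = deg X
  serre : ∀ X Y : A, Ext1IsZero (A := A) X Y ↔ ∀ f : Y ⟶ tau.functor.obj X, f = 0
  riemannRoch : ∀ E F : A,
    (∑ j ∈ Finset.range p,
      ((Module.finrank k ((fpow tau.functor j).obj E ⟶ F) : ℤ) -
        (Module.finrank k (F ⟶ (fpow tau.functor (j + 1)).obj E) : ℤ)))
    = deg F * rk E - deg E * rk F
  -- every indecomposable bundle is semistable: `μ(E') ≤ μ(E)` for subbundles `E'`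
  indec_semistable : ∀ E : A, IsBundle E → Indecomposable E →
    ∀ (Y : A) (f : Y ⟶ E), Mono f → ¬ IsZero Y →
      deg Y * rk E ≤ deg E * rk Y
  -- a non-exceptional indecomposable bundle has a filtration with factors `τⁱG`,
  -- `0 ≤ i < p_E`, for `G` its quasi-top (of the same slope); in particular any object
  -- receiving no nonzero map from the `τ`-orbit of `G` receives no nonzero map from `E`,
  -- and dually
  quasi_top_filtration : ∀ E : A, IsBundle E → Indecomposable E →
    ¬ Ext1IsZero (A := A) E E →
    ∃ G : A, IsBundle G ∧ ¬ IsZero G ∧ deg G * rk E = deg E * rk G ∧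
      (∀ F : A, (∀ j : ℕ, ∀ f : (fpow tau.functor j).obj G ⟶ F, f = 0) →
        ∀ f : E ⟶ F, f = 0) ∧
      (∀ F : A, (∀ j : ℕ, ∀ f : F ⟶ (fpow tau.functor j).obj G, f = 0) →
        ∀ f : F ⟶ E, f = 0)

variable {A : Type u} [Category.{v} A] [Abelian A] [Linear k A]

section Helpers

variable {k}

/-! ### Powers of `τ` -/

instance fpow_isEquivalence (F : A ⥤ A) [F.IsEquivalence] (n : ℕ) : (fpow F n).IsEquivalence := by
  induction n with
  | zero => exact inferInstanceAs (𝟭 A).IsEquivalence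
  | succ n ih => exact inferInstanceAs (fpow F n ⋙ F).IsEquivalence

namespace TubularWPLData

variable (W : TubularWPLData k A)

/-- `τⁿ` as a functor. -/
def Tf (n : ℕ) : A ⥤ A := fpow W.tau.functor n

instance Tf_isEquivalence (n : ℕ) : (W.Tf n).IsEquivalence :=
  inferInstanceAs (fpow W.tau.functor n).IsEquivalence

instance Tf_pzm (n : ℕ) : (W.Tf n).PreservesZeroMorphisms := inferInstance

/-- `τⁿ X`. -/
abbrev T (n : ℕ) (X : A) : A := (W.Tf n).obj X

theorem T_zero (X : A) : W.T 0 X = X := rfl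

theorem T_succ (n : ℕ) (X : A) : W.T (n + 1) X = W.tau.functor.obj (W.T n X) := rfl

theorem T_one (X : A) : W.T 1 X = W.tau.functor.obj X := rfl

theorem T_T (m n : ℕ) (X : A) : W.T m (W.T n X) = W.T (n + m) X := by
  induction m with
  | zero => rfl
  | succ m ih => rw [T_succ, ih]; rfl

theorem T_p (X : A) : Nonempty (W.T W.p X ≅ X) :=
  W.tau_period.elim fun e => ⟨e.app X⟩

theorem T_mul_p (n : ℕ) (X : A) : Nonempty (W.T (n * W.p) X ≅ X) := by
  induction n with
  | zero => rw [Nat.zero_mul]; exact ⟨Iso.refl _⟩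
  | succ n ih =>
    obtain ⟨e⟩ := ih
    obtain ⟨e'⟩ := W.T_p (W.T (n * W.p) X)
    rw [T_T] at e'
    rw [Nat.succ_mul]
    exact ⟨e' ≪≫ e⟩

theorem T_inv (i : ℕ) : ∃ m : ℕ, ∀ X : A, Nonempty (W.T m (W.T i X) ≅ X) ∧
    Nonempty (W.T i (W.T m X) ≅ X) := by
  have hp := W.hp
  refine ⟨i * W.p - i, fun X => ?_⟩
  have h : i ≤ i * W.p := Nat.le_mul_of_pos_right i hp
  rw [T_T, T_T, Nat.add_sub_cancel' h, Nat.sub_add_cancel h]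
  exact ⟨W.T_mul_p i X, W.T_mul_p i X⟩

theorem rk_T (n : ℕ) (X : A) : W.rk (W.T n X) = W.rk X := by
  induction n with
  | zero => rfl
  | succ n ih => rw [T_succ, W.rk_tau, ih]

theorem deg_T (n : ℕ) (X : A) : W.deg (W.T n X) = W.deg X := by
  induction n with
  | zero => rfl
  | succ n ih => rw [T_succ, W.deg_tau, ih]

theorem map_eq_zero {X Y : A} (n : ℕ) (f : X ⟶ Y) (h : (W.Tf n).map f = 0) : f = 0 :=
  (W.Tf n).map_injective (by rw [h, Functor.map_zero])

/-- All maps from the `τ`-orbit of `X` to that of `Y` vanish. -/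
def Orth (X Y : A) : Prop := ∀ (i : ℕ) (f : X ⟶ W.T i Y), f = 0

theorem orth_iff (X Y : A) : W.Orth X Y ↔ ∀ (i : ℕ) (f : W.T i X ⟶ Y), f = 0 := by
  constructor
  · intro h i f
    obtain ⟨m, hm⟩ := W.T_inv i
    obtain ⟨⟨e⟩, -⟩ := hm X
    have := h m (e.inv ≫ (W.Tf m).map f)
    rw [Preadditive.IsIso.comp_left_eq_zero] at this
    exact W.map_eq_zero m f this
  · intro h i f
    obtain ⟨m, hm⟩ := W.T_inv i
    obtain ⟨⟨e⟩, -⟩ := hm Y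
    have := h m ((W.Tf m).map f ≫ e.hom)
    rw [Preadditive.IsIso.comp_right_eq_zero] at this
    exact W.map_eq_zero m f this

/-- The antisymmetric form given by rank and degree. -/
def br (X Y : A) : ℤ := W.deg Y * W.rk X - W.deg X * W.rk Y

theorem br_T_left (n : ℕ) (X Y : A) : W.br (W.T n X) Y = W.br X Y := by
  simp only [br, rk_T, deg_T]

theorem br_T_right (n : ℕ) (X Y : A) : W.br X (W.T n Y) = W.br X Y := by
  simp only [br, rk_T, deg_T]

theorem br_self (X : A) : W.br X X = 0 := by simp [br]

theorem br_symm (X Y : A) : W.br X Y = - W.br Y X := by simp only [br]; ring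

/-- dimension of Hom -/
noncomputable def hd (_W : TubularWPLData k A) (X Y : A) : ℕ := Module.finrank k (X ⟶ Y)

/-- `∑ dim Hom(τʲX, Y)` -/
noncomputable def ah (X Y : A) : ℕ := ∑ j ∈ Finset.range W.p, W.hd (W.T j X) Y

/-- `∑ dim Hom(X, τʲY)` -/
noncomputable def bh (X Y : A) : ℕ := ∑ j ∈ Finset.range W.p, W.hd X (W.T j Y)

theorem hd_iso {X X' Y Y' : A} (e : X ≅ X') (e' : Y ≅ Y') : W.hd X Y = W.hd X' Y' :=
  LinearEquiv.finrank_eq (Linear.homCongr k e e')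

theorem sum_cyc (f : ℕ → ℕ) (p : ℕ) (h : f p = f 0) :
    ∑ j ∈ Finset.range p, f (j + 1) = ∑ j ∈ Finset.range p, f j := by
  have h1 := Finset.sum_range_succ f p
  have h2 := Finset.sum_range_succ' f p
  omega

theorem bh_T (n : ℕ) (X Y : A) : W.bh X (W.T n Y) = W.bh X Y := by
  induction n with
  | zero => rfl
  | succ n ih =>
    rw [← ih, bh, bh, ← sum_cyc (fun j => W.hd X (W.T j (W.T n Y)))]
    · refine Finset.sum_congr rfl fun j _ => ?_
      rw [T_T, T_T]
      congr 2
      ring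
    · obtain ⟨e⟩ := W.T_p (W.T n Y)
      exact W.hd_iso (Iso.refl _) e

theorem RR (X Y : A) : (W.ah X Y : ℤ) - W.bh Y X = W.br X Y := by
  have h := W.riemannRoch X Y
  rw [br, ← h, Finset.sum_sub_distrib]
  congr 1
  · simp only [ah, hd, T, Tf]; push_cast; rfl
  · rw [← W.bh_T 1 Y X]
    simp only [bh]
    push_cast
    refine Finset.sum_congr rfl fun j _ => ?_
    rw [T_T, add_comm]; rfl

theorem ah_self (X : A) : W.ah X X = W.bh X X := by
  have := W.RR X X
  rw [br_self] at this
  omega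

theorem hd_eq_zero {X Y : A} (h : ∀ f : X ⟶ Y, f = 0) : W.hd X Y = 0 := by
  have : Subsingleton (X ⟶ Y) := ⟨fun a b => by rw [h a, h b]⟩
  exact Module.finrank_zero_of_subsingleton

theorem hd_pos {X Y : A} {f : X ⟶ Y} (h : f ≠ 0) : 0 < W.hd X Y := by
  have := W.homFinite X Y
  have : Nontrivial (X ⟶ Y) := ⟨f, 0, h⟩
  exact Module.finrank_pos

theorem ah_eq_zero {X Y : A} (h : W.Orth X Y) : W.ah X Y = 0 := by
  rw [orth_iff] at h
  exact Finset.sum_eq_zero fun j _ => W.hd_eq_zero (h j)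

theorem bh_eq_zero {X Y : A} (h : W.Orth X Y) : W.bh X Y = 0 :=
  Finset.sum_eq_zero fun j _ => W.hd_eq_zero (h j)

theorem ah_pos {X Y : A} {f : X ⟶ Y} (h : f ≠ 0) : 0 < W.ah X Y :=
  lt_of_lt_of_le (W.hd_pos (X := W.T 0 X) h)
    (Finset.single_le_sum (f := fun j => W.hd (W.T j X) Y) (fun _ _ => Nat.zero_le _)
      (Finset.mem_range.2 W.hp))

theorem bh_pos {X Y : A} {f : X ⟶ Y} (h : f ≠ 0) : 0 < W.bh X Y :=
  lt_of_lt_of_le (W.hd_pos (Y := W.T 0 Y) h)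
    (Finset.single_le_sum (f := fun j => W.hd X (W.T j Y)) (fun _ _ => Nat.zero_le _)
      (Finset.mem_range.2 W.hp))

/-! ### Monotonicity -/

theorem hd_mono_right (Z : A) {X Y : A} (m : X ⟶ Y) [Mono m] : W.hd Z X ≤ W.hd Z Y := by
  have := W.homFinite Z Y
  exact LinearMap.finrank_le_finrank_of_injective (f := Linear.rightComp k Z m)
    (fun a b h => (cancel_mono m).1 h)

theorem hd_mono_left (Z : A) {X Y : A} (q : X ⟶ Y) [Epi q] : W.hd Y Z ≤ W.hd X Z := by
  have := W.homFinite X Z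
  exact LinearMap.finrank_le_finrank_of_injective (f := Linear.leftComp k Z q)
    (fun a b h => (cancel_epi q).1 h)

theorem hd_lt_right {X Y : A} (m : X ⟶ Y) [Mono m] (hm : ¬ IsIso m) : W.hd Y X < W.hd Y Y := by
  refine lt_of_le_of_ne (W.hd_mono_right Y m) fun h => hm ?_
  have := W.homFinite Y Y
  have := W.homFinite Y X
  have hs : Function.Surjective (Linear.rightComp k Y m) :=
    (LinearMap.injective_iff_surjective_of_finrank_eq_finrank h).1
      (fun a b h => (cancel_mono m).1 h)
  obtain ⟨s, hs⟩ := hs (𝟙 Y)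
  have hs' : s ≫ m = 𝟙 Y := hs
  have : IsSplitEpi m := ⟨⟨⟨s, hs'⟩⟩⟩
  exact isIso_of_mono_of_isSplitEpi m

theorem hd_lt_left {X Y : A} (q : X ⟶ Y) [Epi q] (hq : ¬ IsIso q) : W.hd Y X < W.hd X X := by
  refine lt_of_le_of_ne (W.hd_mono_left X q) fun h => hq ?_
  have := W.homFinite X X
  have := W.homFinite Y X
  have hs : Function.Surjective (Linear.leftComp k X q) :=
    (LinearMap.injective_iff_surjective_of_finrank_eq_finrank h).1
      (fun a b h => (cancel_epi q).1 h)
  obtain ⟨s, hs⟩ := hs (𝟙 X)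
  have hs' : q ≫ s = 𝟙 X := hs
  have : IsSplitMono q := ⟨⟨⟨s, hs'⟩⟩⟩
  exact isIso_of_epi_of_isSplitMono q

theorem ah_mono_right (Z : A) {X Y : A} (m : X ⟶ Y) [Mono m] : W.ah Z X ≤ W.ah Z Y :=
  Finset.sum_le_sum fun _ _ => W.hd_mono_right _ m

theorem bh_mono_right (Z : A) {X Y : A} (m : X ⟶ Y) [Mono m] : W.bh Z X ≤ W.bh Z Y :=
  Finset.sum_le_sum fun j _ => W.hd_mono_right _ ((W.Tf j).map m)

theorem ah_mono_left (Z : A) {X Y : A} (q : X ⟶ Y) [Epi q] : W.ah Y Z ≤ W.ah X Z :=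
  Finset.sum_le_sum fun j _ => W.hd_mono_left _ ((W.Tf j).map q)

theorem bh_mono_left (Z : A) {X Y : A} (q : X ⟶ Y) [Epi q] : W.bh Y Z ≤ W.bh X Z :=
  Finset.sum_le_sum fun _ _ => W.hd_mono_left _ q

theorem ah_lt_right {X Y : A} (m : X ⟶ Y) [Mono m] (hm : ¬ IsIso m) : W.ah Y X < W.ah Y Y :=
  Finset.sum_lt_sum (fun _ _ => W.hd_mono_right _ m)
    ⟨0, Finset.mem_range.2 W.hp, have h := W.hd_lt_right m hm; h⟩

theorem bh_lt_right {X Y : A} (m : X ⟶ Y) [Mono m] (hm : ¬ IsIso m) : W.bh Y X < W.bh Y Y :=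
  Finset.sum_lt_sum (fun j _ => W.hd_mono_right _ ((W.Tf j).map m))
    ⟨0, Finset.mem_range.2 W.hp, have h := W.hd_lt_right m hm; h⟩

theorem ah_lt_left {X Y : A} (q : X ⟶ Y) [Epi q] (hq : ¬ IsIso q) : W.ah Y X < W.ah X X :=
  Finset.sum_lt_sum (fun j _ => W.hd_mono_left _ ((W.Tf j).map q))
    ⟨0, Finset.mem_range.2 W.hp, have h := W.hd_lt_left q hq; h⟩

theorem ah_iso {X X' Y Y' : A} (e : X ≅ X') (e' : Y ≅ Y') : W.ah X Y = W.ah X' Y' :=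
  Finset.sum_congr rfl fun j _ => W.hd_iso ((W.Tf j).mapIso e) e'

theorem bh_iso {X X' Y Y' : A} (e : X ≅ X') (e' : Y ≅ Y') : W.bh X Y = W.bh X' Y' :=
  Finset.sum_congr rfl fun j _ => W.hd_iso e ((W.Tf j).mapIso e')

theorem br_iso {X X' Y Y' : A} (e : X ≅ X') (e' : Y ≅ Y') : W.br X Y = W.br X' Y' := by
  rw [← W.RR, ← W.RR, W.ah_iso e e', W.bh_iso e' e]

theorem br_zero_left {X : A} (h : IsZero X) (Y : A) : W.br X Y = 0 := by
  have h1 : W.Orth X Y := fun i f => h.eq_of_src f 0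
  have h2 : W.Orth Y X := (W.orth_iff _ _).2 fun i f => h.eq_of_tgt f 0
  rw [← W.RR, W.ah_eq_zero h1, W.bh_eq_zero h2]; rfl

/-- A proper quotient of no larger slope has fewer endomorphisms. -/
theorem ah_quot_lt {Y Q : A} (q : Y ⟶ Q) [Epi q] (hq : ¬ IsIso q) (h : 0 ≤ W.br Q Y) :
    W.ah Q Q < W.ah Y Y := by
  have h1 := W.bh_mono_left Q q
  have h2 := W.RR Q Y
  have h3 := W.ah_lt_left q hq
  have h4 := W.ah_self Q
  omega

/-- A proper subobject of no smaller slope has fewer endomorphisms. -/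
theorem ah_sub_lt {X Y : A} (m : X ⟶ Y) [Mono m] (hm : ¬ IsIso m) (h : W.br X Y ≤ 0) :
    W.ah X X < W.ah Y Y := by
  have h1 := W.ah_mono_right X m
  have h2 := W.RR X Y
  have h3 := W.bh_lt_right m hm
  have h4 := W.ah_self Y
  omega

/-- A monomorphism into a `τ`-translate is an isomorphism. -/
theorem isIso_of_mono_T {X : A} {i : ℕ} (m : X ⟶ W.T i X) [Mono m] : IsIso m := by
  by_contra hm
  have h := W.bh_lt_right m hm
  rw [bh_T] at h
  exact lt_irrefl _ h

/-! ### Short exact sequences -/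

/-- Push-out of a short exact sequence. -/
theorem _root_.ses_pushout {K X Q F : A} {i : K ⟶ X} {q : X ⟶ Q} {w : i ≫ q = 0}
    (h : (ShortComplex.mk i q w).ShortExact) (f : K ⟶ F) :
    ∃ w' : pushout.inr i f ≫ pushout.desc q (0 : F ⟶ Q) (by simp [w]) = 0,
      (ShortComplex.mk (pushout.inr i f) (pushout.desc q (0 : F ⟶ Q) (by simp [w])) w').ShortExact := by
  have hi : Mono i := h.mono_f
  have hq : Epi q := h.epi_g
  refine ⟨pushout.inr_desc _ _ _, ?_⟩
  have hq' : Epi (pushout.desc q (0 : F ⟶ Q) (by simp [w]) : pushout i f ⟶ Q) := by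
    have : Epi (pushout.inl i f ≫ pushout.desc q (0 : F ⟶ Q) (by simp [w])) := by
      rw [pushout.inl_desc]; exact hq
    exact epi_of_epi (pushout.inl i f) _
  have hi' : Mono (pushout.inr i f) := inferInstance
  refine { exact := ?_, mono_f := hi', epi_g := hq' }
  refine ShortComplex.exact_of_g_is_cokernel _ ?_
  refine CokernelCofork.IsColimit.ofπ' _ _ fun {Z} g hg => ?_
  have hk : i ≫ pushout.inl i f ≫ g = 0 := by
    rw [← Category.assoc, pushout.condition, Category.assoc]
    have : pushout.inr i f ≫ g = 0 := hg
    rw [this, comp_zero]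
  refine ⟨h.exact.desc (pushout.inl i f ≫ g) hk, ?_⟩
  apply pushout.hom_ext
  · rw [pushout.inl_desc_assoc]
    exact h.exact.g_desc _ hk
  · rw [pushout.inr_desc_assoc, zero_comp]
    exact hg.symm

/-- Pull-back of a short exact sequence. -/
theorem _root_.ses_pullback {K X Q F : A} {i : K ⟶ X} {q : X ⟶ Q} {w : i ≫ q = 0}
    (h : (ShortComplex.mk i q w).ShortExact) (f : F ⟶ Q) :
    ∃ w' : pullback.lift i (0 : K ⟶ F) (by simp [w]) ≫ pullback.snd q f = 0,
      (ShortComplex.mk (pullback.lift i (0 : K ⟶ F) (by simp [w])) (pullback.snd q f) w').ShortExact := by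
  have hi : Mono i := h.mono_f
  have hq : Epi q := h.epi_g
  refine ⟨pullback.lift_snd _ _ _, ?_⟩
  have hi' : Mono (pullback.lift i (0 : K ⟶ F) (by simp [w]) : K ⟶ pullback q f) := by
    have : Mono (pullback.lift i (0 : K ⟶ F) (by simp [w]) ≫ pullback.fst q f) := by
      rw [pullback.lift_fst]; exact hi
    exact mono_of_mono _ (pullback.fst q f)
  have hq' : Epi (pullback.snd q f) := inferInstance
  refine { exact := ?_, mono_f := hi', epi_g := hq' }
  refine ShortComplex.exact_of_f_is_kernel _ ?_
  refine KernelFork.IsLimit.ofι' _ _ fun {Z} g hg => ?_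
  have hk : (g ≫ pullback.fst q f) ≫ q = 0 := by
    rw [Category.assoc, pullback.condition, ← Category.assoc]
    have : g ≫ pullback.snd q f = 0 := hg
    rw [this, zero_comp]
  refine ⟨h.exact.lift (g ≫ pullback.fst q f) hk, ?_⟩
  apply pullback.hom_ext
  · rw [Category.assoc, pullback.lift_fst]
    exact h.exact.lift_f _ hk
  · rw [Category.assoc, pullback.lift_snd, comp_zero]
    exact hg.symm

theorem _root_.extend_of_ext {K X Q F : A} {i : K ⟶ X} {q : X ⟶ Q} {w : i ≫ q = 0}
    (h : (ShortComplex.mk i q w).ShortExact) (hext : Ext1IsZero Q F) (f : K ⟶ F) :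
    ∃ g : X ⟶ F, i ≫ g = f := by
  obtain ⟨w', h'⟩ := ses_pushout h f
  obtain ⟨r, hr⟩ := hext _ _ _ w' h'.mono_f h'.epi_g h'.exact
  refine ⟨pushout.inl i f ≫ r, ?_⟩
  rw [← Category.assoc, pushout.condition, Category.assoc, hr, Category.comp_id]

theorem _root_.lift_of_ext {K X Q F : A} {i : K ⟶ X} {q : X ⟶ Q} {w : i ≫ q = 0}
    (h : (ShortComplex.mk i q w).ShortExact) (hext : Ext1IsZero F K) (f : F ⟶ Q) :
    ∃ g : F ⟶ X, g ≫ q = f := by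
  obtain ⟨w', h'⟩ := ses_pullback h f
  obtain ⟨r, hr⟩ := hext _ _ _ w' h'.mono_f h'.epi_g h'.exact
  have sp := ShortComplex.Splitting.ofExactOfRetraction _ h'.exact r hr h'.epi_g
  have hs : sp.s ≫ pullback.snd q f = 𝟙 F := sp.s_g
  refine ⟨sp.s ≫ pullback.fst q f, ?_⟩
  rw [Category.assoc, pullback.condition, ← Category.assoc, hs, Category.id_comp]

/-- Rank and degree are additive on the short complex. -/
def Add (S : ShortComplex A) : Prop :=
  W.rk S.X₂ = W.rk S.X₁ + W.rk S.X₃ ∧ W.deg S.X₂ = W.deg S.X₁ + W.deg S.X₃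

theorem Add.br_left {W : TubularWPLData k A} {S : ShortComplex A} (h : W.Add S) (F : A) :
    W.br S.X₂ F = W.br S.X₁ F + W.br S.X₃ F := by
  simp only [br, h.1, h.2]; ring

theorem hd_add_left {S : ShortComplex A} (hS : S.ShortExact) (F : A)
    (h : ∀ f : S.X₁ ⟶ F, ∃ g : S.X₂ ⟶ F, S.f ≫ g = f) :
    W.hd S.X₂ F = W.hd S.X₁ F + W.hd S.X₃ F := by
  have := W.homFinite S.X₂ F
  have := hS.epi_g
  have h1 := LinearMap.finrank_range_add_finrank_ker (Linear.leftComp k F S.f)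
  rw [LinearMap.range_eq_top.2 (fun f => h f), finrank_top] at h1
  have h2 : LinearMap.ker (Linear.leftComp k F S.f) = LinearMap.range (Linear.leftComp k F S.g) := by
    ext g
    simp only [LinearMap.mem_ker, LinearMap.mem_range, Linear.leftComp_apply]
    constructor
    · intro hg
      exact ⟨hS.exact.desc g hg, hS.exact.g_desc g hg⟩
    · rintro ⟨y, rfl⟩
      rw [S.zero_assoc, zero_comp]
  rw [h2, LinearMap.finrank_range_of_inj (fun a b hab => (cancel_epi S.g).1 hab)] at h1
  exact h1.symm

theorem hd_add_right {S : ShortComplex A} (hS : S.ShortExact) (F : A)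
    (h : ∀ f : F ⟶ S.X₃, ∃ g : F ⟶ S.X₂, g ≫ S.g = f) :
    W.hd F S.X₂ = W.hd F S.X₁ + W.hd F S.X₃ := by
  have := W.homFinite F S.X₂
  have := hS.mono_f
  have h1 := LinearMap.finrank_range_add_finrank_ker (Linear.rightComp k F S.g)
  rw [LinearMap.range_eq_top.2 (fun f => h f), finrank_top] at h1
  have h2 : LinearMap.ker (Linear.rightComp k F S.g) = LinearMap.range (Linear.rightComp k F S.f) := by
    ext g
    simp only [LinearMap.mem_ker, LinearMap.mem_range, Linear.rightComp_apply]
    constructor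
    · intro hg
      exact ⟨hS.exact.lift g hg, hS.exact.lift_f g hg⟩
    · rintro ⟨y, rfl⟩
      rw [Category.assoc, S.zero, comp_zero]
  rw [h2, LinearMap.finrank_range_of_inj (fun a b hab => (cancel_mono S.f).1 hab)] at h1
  rw [add_comm]
  exact h1.symm

theorem ses_T (n : ℕ) {S : ShortComplex A} (hS : S.ShortExact) : (S.map (W.Tf n)).ShortExact :=
  hS.map_of_exact (W.Tf n)

theorem br_add {S : ShortComplex A} (hS : S.ShortExact) (F : A)
    (h1 : ∀ (j : ℕ) (f : W.T j S.X₁ ⟶ F), ∃ g : W.T j S.X₂ ⟶ F, (W.Tf j).map S.f ≫ g = f)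
    (h2 : ∀ (j : ℕ) (f : F ⟶ W.T j S.X₃), ∃ g : F ⟶ W.T j S.X₂, g ≫ (W.Tf j).map S.g = f) :
    W.br S.X₂ F = W.br S.X₁ F + W.br S.X₃ F := by
  have e1 : W.ah S.X₂ F = W.ah S.X₁ F + W.ah S.X₃ F := by
    rw [ah, ah, ah, ← Finset.sum_add_distrib]
    exact Finset.sum_congr rfl fun j _ => W.hd_add_left (W.ses_T j hS) F (h1 j)
  have e2 : W.bh F S.X₂ = W.bh F S.X₁ + W.bh F S.X₃ := by
    rw [bh, bh, bh, ← Finset.sum_add_distrib]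
    exact Finset.sum_congr rfl fun j _ => W.hd_add_right (W.ses_T j hS) F (h2 j)
  rw [← W.RR, ← W.RR, ← W.RR, e1, e2]
  push_cast
  ring

theorem br_add_of_orth_right {S : ShortComplex A} (hS : S.ShortExact) (F : A)
    (h : W.Orth F S.X₃) : W.br S.X₂ F = W.br S.X₁ F + W.br S.X₃ F := by
  refine W.br_add hS F (fun j f => ?_) (fun j f => ⟨0, by rw [zero_comp, h j f]⟩)
  exact extend_of_ext (W.ses_T j hS) ((W.serre _ _).2 fun f => h (j + 1) f) f

theorem br_add_of_orth_left {S : ShortComplex A} (hS : S.ShortExact) (F : A)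
    (h : W.Orth S.X₁ F) : W.br S.X₂ F = W.br S.X₁ F + W.br S.X₃ F := by
  have h' := (W.orth_iff _ _).1 h
  refine W.br_add hS F (fun j f => ⟨0, by rw [comp_zero, h' j f]⟩) (fun j f => ?_)
  refine lift_of_ext (W.ses_T j hS) ((W.serre _ _).2 fun f => ?_) f
  obtain ⟨m, hm⟩ := W.T_inv j
  obtain ⟨⟨e⟩, -⟩ := hm S.X₁
  have key : ∀ f : W.T j S.X₁ ⟶ W.T 1 F, f = 0 := by
    intro f
    refine W.map_eq_zero m f ?_
    have h3 := h (1 + m) (e.inv ≫ (W.Tf m).map f ≫ eqToHom (W.T_T m 1 F))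
    rwa [Preadditive.IsIso.comp_left_eq_zero, Preadditive.IsIso.comp_right_eq_zero] at h3
  exact key f

theorem add_of_two {S : ShortComplex A} {F G : A} (hFG : W.br F G ≠ 0)
    (hF : W.br S.X₂ F = W.br S.X₁ F + W.br S.X₃ F)
    (hG : W.br S.X₂ G = W.br S.X₁ G + W.br S.X₃ G) : W.Add S := by
  simp only [br] at hF hG hFG
  constructor
  · have : (W.rk S.X₂ - (W.rk S.X₁ + W.rk S.X₃)) *
      (W.deg G * W.rk F - W.deg F * W.rk G) = 0 := by
      linear_combination W.rk F * hG - W.rk G * hF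
    have := (mul_eq_zero.1 this).resolve_right hFG
    linarith
  · have : (W.deg S.X₂ - (W.deg S.X₁ + W.deg S.X₃)) *
      (W.deg G * W.rk F - W.deg F * W.rk G) = 0 := by
      linear_combination W.deg F * hG - W.deg G * hF
    have := (mul_eq_zero.1 this).resolve_right hFG
    linarith

/-- nondegeneracy of the form -/
def Nondeg : Prop := ∃ P Q : A, W.br P Q ≠ 0

theorem add_of_split (hN : W.Nondeg) (X Y : A) :
    W.rk (X ⊞ Y) = W.rk X + W.rk Y ∧ W.deg (X ⊞ Y) = W.deg X + W.deg Y := by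
  obtain ⟨P, Q, hPQ⟩ := hN
  have sp := ShortComplex.Splitting.ofHasBinaryBiproduct X Y
  have hS := sp.shortExact
  have key : ∀ F : A, W.br (X ⊞ Y) F = W.br X F + W.br Y F := by
    intro F
    refine W.br_add hS F (fun j f => ⟨(W.Tf j).map sp.r ≫ f, ?_⟩)
      (fun j f => ⟨f ≫ (W.Tf j).map sp.s, ?_⟩)
    · rw [← Category.assoc, ← Functor.map_comp, sp.f_r, CategoryTheory.Functor.map_id, Category.id_comp]
    · rw [Category.assoc, ← Functor.map_comp, sp.s_g, CategoryTheory.Functor.map_id, Category.comp_id]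
  exact W.add_of_two (S := ShortComplex.mk (biprod.inl : X ⟶ X ⊞ Y) biprod.snd (by simp))
    hPQ (key P) (key Q)

theorem phi_iso (hN : W.Nondeg) {X Y : A} (e : X ≅ Y) : W.rk X = W.rk Y ∧ W.deg X = W.deg Y := by
  obtain ⟨P, Q, hPQ⟩ := hN
  have h1 := W.br_iso e (Iso.refl P)
  have h2 := W.br_iso e (Iso.refl Q)
  simp only [br] at h1 h2 hPQ
  constructor
  · have : (W.rk X - W.rk Y) * (W.deg Q * W.rk P - W.deg P * W.rk Q) = 0 := by
      linear_combination W.rk P * h2 - W.rk Q * h1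
    have := (mul_eq_zero.1 this).resolve_right hPQ
    linarith
  · have : (W.deg X - W.deg Y) * (W.deg Q * W.rk P - W.deg P * W.rk Q) = 0 := by
      linear_combination W.deg P * h2 - W.deg Q * h1
    have := (mul_eq_zero.1 this).resolve_right hPQ
    linarith

theorem add_of_zero_left (hN : W.Nondeg) {S : ShortComplex A} (hS : S.ShortExact)
    (h : IsZero S.X₁) : W.Add S := by
  obtain ⟨P, Q, hPQ⟩ := hN
  have key : ∀ F, W.Orth S.X₁ F := fun F i f => h.eq_of_src _ _
  exact W.add_of_two hPQ (W.br_add_of_orth_left hS P (key P)) (W.br_add_of_orth_left hS Q (key Q))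

theorem _root_.ses_kernel {X Y : A} (q : X ⟶ Y) [Epi q] :
    (ShortComplex.mk (kernel.ι q) q (kernel.condition q)).ShortExact where
  exact := ShortComplex.exact_of_f_is_kernel _ (kernelIsKernel q)
  mono_f := by dsimp; infer_instance
  epi_g := by dsimp; infer_instance

theorem _root_.ses_cokernel {X Y : A} (m : X ⟶ Y) [Mono m] :
    (ShortComplex.mk m (cokernel.π m) (cokernel.condition m)).ShortExact where
  exact := ShortComplex.exact_of_g_is_cokernel _ (cokernelIsCokernel m)
  mono_f := by dsimp; infer_instance
  epi_g := by dsimp; infer_instance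

/-! ### Bundles and bricks -/

theorem isBundle_sub {X Y : A} (m : X ⟶ Y) [Mono m] (hY : IsBundle Y) : IsBundle X :=
  fun Z f hf hZ => hY Z (f ≫ m) (mono_comp f m) hZ

theorem isBundle_T (i : ℕ) {Y : A} (hY : IsBundle Y) : IsBundle (W.T i Y) := by
  intro Z f hf hZ
  obtain ⟨m, hm⟩ := W.T_inv i
  obtain ⟨⟨e⟩, -⟩ := hm Y
  have h1 : IsZero (W.T m Z) := by
    refine hY _ ((W.Tf m).map f ≫ e.hom) inferInstance ?_
    rw [← W.rk_zero_iff_torsion, W.rk_T, W.rk_zero_iff_torsion]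
    exact hZ
  rw [IsZero.iff_id_eq_zero] at h1 ⊢
  refine W.map_eq_zero m _ ?_
  rw [CategoryTheory.Functor.map_id]
  exact h1

theorem not_isZero_T (i : ℕ) {Y : A} (hY : ¬ IsZero Y) : ¬ IsZero (W.T i Y) := by
  rw [IsZero.iff_id_eq_zero] at hY ⊢
  intro h
  refine hY (W.map_eq_zero i _ ?_)
  rw [CategoryTheory.Functor.map_id]
  exact h

/-- An orbit brick: a nonzero bundle such that all maps to `τ`-translates are zero or
isomorphisms. -/
structure OB (X : A) : Prop where
  bundle : IsBundle X
  ne : ¬ IsZero X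
  brick : ∀ (i : ℕ) (f : X ⟶ W.T i X), f = 0 ∨ IsIso f

theorem _root_.ne_zero_of_epi {X Y : A} (f : X ⟶ Y) [Epi f] (h : ¬ IsZero Y) : f ≠ 0 := by
  rintro rfl
  exact h (IsZero.of_epi_zero X Y)

theorem _root_.ne_zero_of_mono {X Y : A} (f : X ⟶ Y) [Mono f] (h : ¬ IsZero X) : f ≠ 0 := by
  rintro rfl
  exact h (IsZero.of_mono_zero X Y)

/-- Every nonzero bundle has an orbit brick as a quotient which is also a subobject up to
translation. -/
theorem exists_brick {Y : A} (hY : IsBundle Y) (hY0 : ¬ IsZero Y) :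
    ∃ X : A, W.OB X ∧ (∃ q : Y ⟶ X, Epi q) ∧ ∃ (i : ℕ) (m : X ⟶ W.T i Y), Mono m := by
  classical
  let P : ℕ → Prop := fun n => ∃ X : A, ¬ IsZero X ∧ W.ah X X = n ∧ (∃ q : Y ⟶ X, Epi q) ∧
    ∃ (i : ℕ) (m : X ⟶ W.T i Y), Mono m
  have hP : ∃ n, P n := ⟨_, Y, hY0, rfl, ⟨𝟙 Y, inferInstance⟩, 0, 𝟙 Y, by
    exact inferInstanceAs (Mono (𝟙 Y))⟩
  obtain ⟨X, hX0, hn, ⟨q, hq⟩, i, m, hm⟩ := Nat.find_spec hP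
  have hmin : ∀ X' : A, ¬ IsZero X' → (∃ q : Y ⟶ X', Epi q) →
      (∃ (i : ℕ) (m : X' ⟶ W.T i Y), Mono m) → W.ah X X ≤ W.ah X' X' := by
    intro X' h1 h2 h3
    rw [hn]
    exact Nat.find_min' hP ⟨X', h1, rfl, h2, h3⟩
  have hXb : IsBundle X := isBundle_sub m (W.isBundle_T i hY)
  have hind : Indecomposable X := by
    refine ⟨hX0, fun U V e => ?_⟩
    by_contra hUV
    push Not at hUV
    obtain ⟨hU, hV⟩ := hUV
    have hmo : Mono (biprod.inl ≫ e.inv : U ⟶ X) := inferInstance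
    have hep : Epi (e.hom ≫ biprod.fst : X ⟶ U) := inferInstance
    have hni : ¬ IsIso (biprod.inl ≫ e.inv : U ⟶ X) := by
      intro h
      have h1 : IsIso (biprod.inl : U ⟶ U ⊞ V) := IsIso.of_isIso_comp_right _ e.inv
      have h2 : (biprod.snd : U ⊞ V ⟶ V) = 0 := by
        rw [← cancel_epi (biprod.inl : U ⟶ U ⊞ V)]
        simp
      exact ne_zero_of_epi _ hV h2
    have h1 := hmin U hU ⟨q ≫ (e.hom ≫ biprod.fst), epi_comp _ _⟩
      ⟨i, (biprod.inl ≫ e.inv) ≫ m, mono_comp _ _⟩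
    have h2 := W.ah_mono_left U (e.hom ≫ biprod.fst : X ⟶ U)
    have h3 := W.ah_lt_right (biprod.inl ≫ e.inv : U ⟶ X) hni
    omega
  refine ⟨X, ⟨hXb, hX0, fun j f => ?_⟩, ⟨q, hq⟩, i, m, hm⟩
  by_contra hf
  push Not at hf
  obtain ⟨hf0, hfi⟩ := hf
  have hI0 : ¬ IsZero (image f) := by
    intro h
    apply hf0
    rw [← image.fac f, h.eq_of_src (image.ι f) 0, comp_zero]
  obtain ⟨n, hn'⟩ := W.T_inv j
  obtain ⟨⟨e⟩, -⟩ := hn' X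
  have hs := W.indec_semistable X hXb hind (W.T n (image f)) ((W.Tf n).map (image.ι f) ≫ e.hom)
    inferInstance (W.not_isZero_T n hI0)
  rw [rk_T, deg_T] at hs
  by_cases hiso : IsIso (factorThruImage f)
  · apply hfi
    have : Mono f := by
      rw [← image.fac f]; infer_instance
    exact W.isIso_of_mono_T f
  · have h1 := W.ah_quot_lt (factorThruImage f) hiso (by rw [br]; linarith)
    have h2 := hmin (image f) hI0 ⟨q ≫ factorThruImage f, epi_comp _ _⟩
      ⟨i + j, image.ι f ≫ (W.Tf j).map m ≫ eqToHom (W.T_T j i Y), inferInstance⟩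
    omega

theorem OB.rk_pos {W : TubularWPLData k A} {X : A} (h : W.OB X) : 0 < W.rk X :=
  W.rk_pos_of_bundle X h.bundle h.ne

theorem _root_.isIso_of_map {W : TubularWPLData k A} {X Y : A} (i : ℕ) (f : X ⟶ Y)
    (h : IsIso ((W.Tf i).map f)) : IsIso f := isIso_of_reflects_iso f (W.Tf i)

theorem OB.orth_sub {W : TubularWPLData k A} {X U : A} (h : W.OB X) (m : U ⟶ X) [Mono m]
    (hm : ¬ IsIso m) : W.Orth X U := by
  intro i f
  rcases h.brick i (f ≫ (W.Tf i).map m) with h0 | h1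
  · exact zero_of_comp_mono _ h0
  · exfalso
    have : Epi ((W.Tf i).map m) := epi_of_epi f _
    have : IsIso ((W.Tf i).map m) := isIso_of_mono_of_epi _
    exact hm (isIso_of_map i m this)

theorem OB.orth_quot {W : TubularWPLData k A} {X Q : A} (h : W.OB X) (q : X ⟶ Q) [Epi q]
    (hq : ¬ IsIso q) : W.Orth Q X := by
  intro i f
  rcases h.brick i (q ≫ f) with h0 | h1
  · exact zero_of_epi_comp _ h0
  · exfalso
    have : Mono q := mono_of_mono q f
    exact hq (isIso_of_mono_of_epi _)

theorem OB.br_sub {W : TubularWPLData k A} {X U : A} (h : W.OB X) (m : U ⟶ X) [Mono m]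
    (hm : ¬ IsIso m) (hU : ¬ IsZero U) : 0 < W.br U X := by
  rw [← W.RR, W.bh_eq_zero (h.orth_sub m hm)]
  have := W.ah_pos (ne_zero_of_mono m hU)
  omega

theorem OB.br_quot {W : TubularWPLData k A} {X Q : A} (h : W.OB X) (q : X ⟶ Q) [Epi q]
    (hq : ¬ IsIso q) (hQ : ¬ IsZero Q) : W.br Q X < 0 := by
  rw [← W.RR, W.ah_eq_zero (h.orth_quot q hq)]
  have := W.bh_pos (ne_zero_of_epi q hQ)
  omega

theorem _root_.finiteLength_of_no_sub {X : A} (hX : ¬ IsZero X)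
    (h : ∀ (U : A) (m : U ⟶ X), Mono m → ¬ IsZero U → IsIso m) : FiniteLengthObj X := by
  have : Simple X := by
    refine ⟨fun {Y} f hf => ⟨fun hi h0 => ?_, fun h0 => ?_⟩⟩
    · subst h0
      exact hX (IsZero.of_epi_zero Y X)
    · refine h Y f hf fun hY => h0 (hY.eq_of_src _ _)
  have := (simple_iff_subobject_isSimpleOrder X).1 this
  have hfin : Finite (Subobject X) := by
    classical
    refine Finite.of_surjective (fun b : Bool => if b then (⊤ : Subobject X) else ⊥) fun x => ?_
    rcases eq_bot_or_eq_top x with rfl | rfl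
    · exact ⟨false, by simp⟩
    · exact ⟨true, by simp⟩
  exact ⟨inferInstance, inferInstance⟩

theorem exists_proper_sub {X : A} (hX : IsBundle X) (hX0 : ¬ IsZero X) :
    ∃ (U : A) (m : U ⟶ X), Mono m ∧ ¬ IsZero U ∧ ¬ IsIso m := by
  by_contra hcon
  push Not at hcon
  exact hX0 (hX X (𝟙 X) inferInstance (finiteLength_of_no_sub hX0 hcon))

/-- Sequences starting with an orbit brick are additive. -/
theorem add_of_brick_left {S : ShortComplex A} (hS : S.ShortExact) (h : W.OB S.X₁) : W.Add S := by
  classical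
  by_cases hex : ∃ (U V : A) (m : U ⟶ S.X₁) (n : V ⟶ S.X₁), Mono m ∧ Mono n ∧ ¬ IsIso m ∧
      ¬ IsIso n ∧ W.br U V ≠ 0
  · obtain ⟨U, V, m, n, hm, hn, hm', hn', hUV⟩ := hex
    exact W.add_of_two hUV (W.br_add_of_orth_left hS U (h.orth_sub m hm'))
      (W.br_add_of_orth_left hS V (h.orth_sub n hn'))
  · exfalso
    push Not at hex
    let P : ℕ → Prop := fun c => ∃ (U : A) (m : U ⟶ S.X₁), Mono m ∧ ¬ IsZero U ∧ ¬ IsIso m ∧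
      W.ah U U = c
    have hP : ∃ c, P c := by
      obtain ⟨U, m, h1, h2, h3⟩ := exists_proper_sub h.bundle h.ne
      exact ⟨_, U, m, h1, h2, h3, rfl⟩
    obtain ⟨U, m, hm, hU, hmi, hc⟩ := Nat.find_spec hP
    obtain ⟨V, n, hn, hV, hni⟩ := exists_proper_sub (isBundle_sub m h.bundle) hU
    have hnm : ¬ IsIso (n ≫ m) := by
      intro hi
      have : Epi m := epi_of_epi n m
      exact hmi (isIso_of_mono_of_epi m)
    have h1 := W.ah_sub_lt n hni (hex V U (n ≫ m) m (mono_comp _ _) hm hnm hmi).le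
    have h2 := Nat.find_min' hP ⟨V, n ≫ m, mono_comp _ _, hV, hnm, rfl⟩
    omega

/-- Sequences ending with an orbit brick are additive. -/
theorem add_of_brick_right (hN : W.Nondeg) {S : ShortComplex A} (hS : S.ShortExact)
    (h : W.OB S.X₃) : W.Add S := by
  classical
  by_cases hex : ∃ (U V : A) (m : S.X₃ ⟶ U) (n : S.X₃ ⟶ V), Epi m ∧ Epi n ∧ ¬ IsIso m ∧
      ¬ IsIso n ∧ W.br U V ≠ 0
  · obtain ⟨U, V, m, n, hm, hn, hm', hn', hUV⟩ := hex
    exact W.add_of_two hUV (W.br_add_of_orth_right hS U (h.orth_quot m hm'))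
      (W.br_add_of_orth_right hS V (h.orth_quot n hn'))
  · push Not at hex
    let P : ℕ → Prop := fun c => ∃ (U : A) (m : S.X₃ ⟶ U), Epi m ∧ ¬ IsZero U ∧ ¬ IsIso m ∧
      W.ah U U = c
    have hco : ∀ {U X : A} (m : U ⟶ X), Mono m → ¬ IsZero U → ¬ IsIso m →
        ¬ IsZero (cokernel m) ∧ ¬ IsIso (cokernel.π m) := by
      intro U X m hm hU hmi
      constructor
      · intro h0
        have : Epi m := Preadditive.epi_of_cokernel_zero (h0.eq_of_tgt _ _)
        exact hmi (isIso_of_mono_of_epi m)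
      · intro hi
        have := cokernel.condition m
        rw [Preadditive.IsIso.comp_right_eq_zero] at this
        exact ne_zero_of_mono m hU this
    have hP : ∃ c, P c := by
      obtain ⟨U, m, h1, h2, h3⟩ := exists_proper_sub h.bundle h.ne
      obtain ⟨h4, h5⟩ := hco m h1 h2 h3
      exact ⟨_, _, cokernel.π m, inferInstance, h4, h5, rfl⟩
    obtain ⟨Q, q, hq, hQ, hqi, hc⟩ := Nat.find_spec hP
    have hfl : FiniteLengthObj Q := by
      refine finiteLength_of_no_sub hQ fun U m hm hU => ?_
      by_contra hmi
      obtain ⟨h4, h5⟩ := hco m hm hU hmi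
      have h6 : ¬ IsIso (q ≫ cokernel.π m) := by
        intro hi
        have : Mono q := mono_of_mono q (cokernel.π m)
        exact hqi (isIso_of_mono_of_epi q)
      have h1 := W.ah_quot_lt (cokernel.π m) h5
        (hex _ Q (q ≫ cokernel.π m) q (epi_comp _ _) hq h6 hqi).ge
      have h2 := Nat.find_min' hP ⟨_, q ≫ cokernel.π m, epi_comp _ _, h4, h6, rfl⟩
      omega
    have hrk := (W.rk_zero_iff_torsion Q).2 hfl
    have hbr := h.br_quot q hqi hQ
    obtain ⟨n, hn⟩ := W.T_inv 1
    obtain ⟨-, ⟨e⟩⟩ := hn Q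
    have hext : ¬ Ext1IsZero (W.T n Q) S.X₃ := by
      rw [W.serre]
      intro h0
      have : q ≫ e.inv = 0 := h0 (q ≫ e.inv)
      rw [Preadditive.IsIso.comp_right_eq_zero] at this
      exact ne_zero_of_epi q hQ this
    unfold Ext1IsZero at hext
    push Not at hext
    obtain ⟨M, i, r, w, hi, hr, hex', hns⟩ := hext
    have hS' : (ShortComplex.mk i r w).ShortExact := { exact := hex', mono_f := hi, epi_g := hr }
    have hadd := W.add_of_brick_left hS' h
    have hOrth : W.Orth M S.X₃ := by
      intro j f
      rcases h.brick j (i ≫ f) with h0 | h1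
      · have hg := hS'.exact.g_desc f h0
        have hz : hS'.exact.desc f h0 = 0 := by
          have h3 := h.orth_quot q hqi
          refine W.map_eq_zero 1 _ ?_
          have h4 := h3 (j + 1) (e.inv ≫ (W.Tf 1).map (hS'.exact.desc f h0))
          exact zero_of_epi_comp e.inv h4
        rw [← hg, hz, comp_zero]
      · exfalso
        refine hns (f ≫ inv (i ≫ f)) ?_
        rw [← Category.assoc, IsIso.hom_inv_id]
    refine W.add_of_two (F := M) (G := Q) ?_ (W.br_add_of_orth_right hS M hOrth)
      (W.br_add_of_orth_right hS Q (h.orth_quot q hqi))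
    have e1 : W.rk M = W.rk S.X₃ := by
      have := hadd.1
      dsimp only at this
      rw [this, W.rk_T, hrk, add_zero]
    have := h.rk_pos
    simp only [br, e1, hrk] at hbr ⊢
    simp only [mul_zero, sub_zero] at hbr ⊢
    nlinarith

/-! ### Semistable bundles of a fixed slope -/

theorem OB_T (i : ℕ) {X : A} (h : W.OB X) : W.OB (W.T i X) := by
  refine ⟨W.isBundle_T i h.bundle, W.not_isZero_T i h.ne, fun j f => ?_⟩
  obtain ⟨m, hm⟩ := W.T_inv i
  obtain ⟨⟨e⟩, -⟩ := hm X
  have hT : W.T m (W.T j (W.T i X)) = W.T (i + j + m) X := by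
    rw [W.T_T j i X, W.T_T]
  rcases h.brick (i + j + m) (e.inv ≫ (W.Tf m).map f ≫ eqToHom hT) with h0 | h1
  · left
    refine W.map_eq_zero m f ?_
    rwa [Preadditive.IsIso.comp_left_eq_zero, Preadditive.IsIso.comp_right_eq_zero] at h0
  · right
    refine isIso_of_map (W := W) m f ?_
    have h2 : IsIso ((W.Tf m).map f ≫ eqToHom hT) := IsIso.of_isIso_comp_left e.inv _
    exact IsIso.of_isIso_comp_right _ (eqToHom hT)

theorem _root_.image_not_isZero {X Y : A} {f : X ⟶ Y} (hf : f ≠ 0) : ¬ IsZero (image f) := by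
  intro h
  apply hf
  rw [← image.fac f, h.eq_of_src (image.ι f) 0, comp_zero]

theorem hom_torsion (hN : W.Nondeg) {Z B : A} (hZ : W.rk Z = 0) (hB : IsBundle B) (f : Z ⟶ B) :
    f = 0 := by
  by_contra hf
  obtain ⟨X, hX, ⟨q, hq⟩, -⟩ :=
    W.exists_brick (isBundle_sub (image.ι f) hB) (image_not_isZero hf)
  have hadd := W.add_of_brick_right hN (ses_kernel (factorThruImage f ≫ q)) hX
  have h1 := hadd.1
  dsimp only at h1
  have h2 := W.rk_nonneg (kernel (factorThruImage f ≫ q))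
  have h3 := hX.rk_pos
  omega

theorem orth_torsion (hN : W.Nondeg) {Z B : A} (hZ : W.rk Z = 0) (hB : IsBundle B) :
    W.Orth Z B := fun i f => W.hom_torsion hN hZ (W.isBundle_T i hB) f

/-- semistable bundles of the slope of `R` -/
structure SS (R Y : A) : Prop where
  bundle : IsBundle Y
  par : W.br Y R = 0
  sub : ∀ (U : A) (m : U ⟶ Y), Mono m → 0 ≤ W.br U R

theorem SS_T {R Y : A} (i : ℕ) (h : W.SS R Y) : W.SS R (W.T i Y) := by
  refine ⟨W.isBundle_T i h.bundle, by rw [W.br_T_left, h.par], fun U m hm => ?_⟩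
  obtain ⟨n, hn⟩ := W.T_inv i
  obtain ⟨⟨e⟩, -⟩ := hn Y
  have := h.sub (W.T n U) ((W.Tf n).map m ≫ e.hom) inferInstance
  rwa [W.br_T_left] at this

theorem SS_sub {R Y U : A} (h : W.SS R Y) (m : U ⟶ Y) [Mono m] (h0 : W.br U R = 0) :
    W.SS R U :=
  ⟨isBundle_sub m h.bundle, h0, fun V n _ => h.sub V (n ≫ m) (mono_comp _ _)⟩

theorem SS_of_indec {E : A} (hE : IsBundle E) (hi : Indecomposable E) : W.SS E E := by
  refine ⟨hE, W.br_self E, fun U m hm => ?_⟩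
  by_cases h0 : IsZero U
  · rw [W.br_zero_left h0]
  · have := W.indec_semistable E hE hi U m hm h0
    rw [br]; linarith

theorem br_trans (U X R : A) :
    W.br U R * W.rk X = W.br U X * W.rk R + W.br X R * W.rk U := by
  simp only [br]; ring

theorem SS_of_OB {R X : A} (hR : 0 < W.rk R) (h : W.OB X) (h0 : W.br X R = 0) : W.SS R X := by
  refine ⟨h.bundle, h0, fun U m hm => ?_⟩
  by_cases hz : IsZero U
  · rw [W.br_zero_left hz]
  have h1 : 0 ≤ W.br U X := by
    by_cases hi : IsIso m
    · rw [W.br_iso (asIso m) (Iso.refl X), W.br_self]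
    · exact (h.br_sub m hi hz).le
  have h2 := W.br_trans U X R
  rw [h0, zero_mul, add_zero] at h2
  have h3 := h.rk_pos
  have h4 : 0 ≤ W.br U R * W.rk X := by rw [h2]; positivity
  exact nonneg_of_mul_nonneg_left h4 h3

theorem SS.brick_par {W : TubularWPLData k A} (hN : W.Nondeg) {R K U X D : A} (hU : W.SS R U)
    (hD : W.SS R D) {a : K ⟶ U} {b : U ⟶ X} {w : a ≫ b = 0}
    (hS : (ShortComplex.mk a b w).ShortExact) (hX : W.OB X) (i : ℕ) (m : X ⟶ W.T i D) [Mono m] :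
    W.br X R = 0 ∧ W.SS R K ∧ W.rk U = W.rk K + W.rk X := by
  have hadd := W.add_of_brick_right hN hS hX
  have ha : Mono a := hS.mono_f
  have h1 := hadd.br_left R
  dsimp only at h1
  have h2 := hU.sub K a ha
  have h3 := (W.SS_T i hD).sub X m inferInstance
  have h4 := hU.par
  exact ⟨by omega, W.SS_sub hU a (by omega), hadd.1⟩

theorem hom_SS_eq_zero (hN : W.Nondeg) {R₁ R₂ P Y : A} (h1 : 0 < W.rk R₁) (h2 : 0 < W.rk R₂)
    (h : 0 < W.br R₂ R₁) (hP : W.SS R₁ P) (hY : W.SS R₂ Y) (g : P ⟶ Y) : g = 0 := by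
  by_contra hg
  obtain ⟨X, hX, ⟨q, hq⟩, i, m, hm⟩ :=
    W.exists_brick (isBundle_sub (image.ι g) hY.bundle) (image_not_isZero hg)
  have hS := ses_kernel (factorThruImage g ≫ q)
  have hadd := (W.add_of_brick_right hN hS hX).br_left R₁
  dsimp only at hadd
  have h3 := hP.sub _ (kernel.ι (factorThruImage g ≫ q)) inferInstance
  have h4 := (W.SS_T i hY).sub X (m ≫ (W.Tf i).map (image.ι g)) inferInstance
  have h5 := hP.par
  have h6 : W.br X R₁ ≤ 0 := by omega
  have h7 := hX.rk_pos
  have h8 := W.br_trans X R₂ R₁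
  have h9 : 0 < W.br R₂ R₁ * W.rk X := by positivity
  have h10 : 0 ≤ W.br X R₂ * W.rk R₁ := by positivity
  have h11 : W.br X R₁ * W.rk R₂ ≤ 0 := mul_nonpos_of_nonpos_of_nonneg h6 h2.le
  linarith

theorem _root_.ses_preimage {U J X : A} (e : U ⟶ J) (t : J ⟶ X) [Epi e] [Epi t] :
    ∃ w : pullback.fst e (kernel.ι t) ≫ e ≫ t = 0,
      (ShortComplex.mk (pullback.fst e (kernel.ι t)) (e ≫ t) w).ShortExact := by
  have w : pullback.fst e (kernel.ι t) ≫ e ≫ t = 0 := by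
    rw [pullback.condition_assoc, kernel.condition, comp_zero]
  refine ⟨w, { exact := ?_, mono_f := ?_, epi_g := ?_ }⟩
  · refine ShortComplex.exact_of_f_is_kernel _ ?_
    refine KernelFork.IsLimit.ofι' _ _ fun {Z} g hg => ?_
    have hg' : (g ≫ e) ≫ t = 0 := by rw [Category.assoc]; exact hg
    exact ⟨pullback.lift g (kernel.lift t (g ≫ e) hg') (by rw [kernel.lift_ι]),
      pullback.lift_fst _ _ _⟩
  · dsimp; infer_instance
  · dsimp; infer_instance

theorem _root_.ses_pushout_epi {U Y X : A} (f : U ⟶ Y) (t : U ⟶ X) [Mono f] [Epi t] :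
    ∃ w : (kernel.ι t ≫ f) ≫ pushout.inl f t = 0,
      (ShortComplex.mk (kernel.ι t ≫ f) (pushout.inl f t) w).ShortExact := by
  have w : (kernel.ι t ≫ f) ≫ pushout.inl f t = 0 := by
    rw [Category.assoc, pushout.condition, kernel.condition_assoc, zero_comp]
  refine ⟨w, { exact := ?_, mono_f := ?_, epi_g := ?_ }⟩
  · refine ShortComplex.exact_of_g_is_cokernel _ ?_
    refine CokernelCofork.IsColimit.ofπ' _ _ fun {Z} g hg => ?_
    have hg' : kernel.ι t ≫ f ≫ g = 0 := by rw [← Category.assoc]; exact hg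
    have hd := (ses_kernel t).exact.g_desc (f ≫ g) hg'
    exact ⟨pushout.desc g ((ses_kernel t).exact.desc (f ≫ g) hg') hd.symm,
      pushout.inl_desc _ _ _⟩
  · dsimp; infer_instance
  · dsimp; infer_instance

/-- Sequences starting with a semistable bundle are additive. -/
theorem SS_add (hN : W.Nondeg) {R : A} (n : ℕ) : ∀ {U Y C : A} {f : U ⟶ Y} {g : Y ⟶ C}
    {w : f ≫ g = 0}, (ShortComplex.mk f g w).ShortExact → W.SS R U → (W.rk U).toNat = n →
    W.Add (ShortComplex.mk f g w) := by
  induction n using Nat.strong_induction_on with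
  | _ n ih =>
  intro U Y C f g w hS hU hn
  by_cases hz : IsZero U
  · exact W.add_of_zero_left hN hS hz
  obtain ⟨X, hX, ⟨t, ht⟩, i, m, hm⟩ := W.exists_brick hU.bundle hz
  have hf : Mono f := hS.mono_f
  obtain ⟨h0, hK, hrk⟩ := hU.brick_par hN hU (ses_kernel t) hX i m
  have hX0 := hX.rk_pos
  have hK0 := W.rk_nonneg (kernel t)
  obtain ⟨w1, hP⟩ := ses_pushout hS t
  have a1 := W.add_of_brick_left hP hX
  obtain ⟨w2, hQ⟩ := ses_pushout_epi f t
  have a2 := ih _ (by omega) hQ hK rfl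
  have a3 := W.add_of_brick_right hN (ses_kernel t) hX
  unfold Add at *
  dsimp only at *
  omega

theorem SS_quot (hN : W.Nondeg) {R : A} (hR : 0 < W.rk R) {U Y C : A} {f : U ⟶ Y} {g : Y ⟶ C}
    {w : f ≫ g = 0} (hS : (ShortComplex.mk f g w).ShortExact) (hU : W.SS R U) (hY : W.SS R Y) :
    W.SS R C := by
  have hsub : ∀ (V : A) (n : V ⟶ C), Mono n → 0 ≤ W.br V R := by
    intro V n hn
    obtain ⟨w1, hP⟩ := ses_pullback hS n
    have h1 := (W.SS_add hN _ hP hU rfl).br_left R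
    dsimp only at h1
    have h2 := hY.sub _ (pullback.fst g n) inferInstance
    have h3 := hU.par
    omega
  refine ⟨?_, ?_, hsub⟩
  · intro Z n hn hZ
    by_contra hZ0
    have hrk := (W.rk_zero_iff_torsion Z).2 hZ
    have h1 := hsub Z n hn
    have hg : Epi g := hS.epi_g
    have hV : IsBundle (pullback g n) := isBundle_sub (pullback.fst g n) hY.bundle
    have h2 := W.RR (pullback g n) Z
    rw [W.bh_eq_zero (W.orth_torsion hN hrk hV)] at h2
    have h3 := W.ah_pos (ne_zero_of_epi (pullback.snd g n) hZ0)
    have h4 := W.rk_nonneg (pullback g n)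
    simp only [br, hrk, mul_zero, zero_sub, sub_zero] at h1 h2
    have h5 : W.deg Z ≤ 0 := by nlinarith
    have h6 : W.deg Z * W.rk (pullback g n) ≤ 0 := mul_nonpos_of_nonpos_of_nonneg h5 h4
    omega
  · have h1 := (W.SS_add hN _ hS hU rfl).br_left R
    dsimp only at h1
    have h3 := hU.par
    have h4 := hY.par
    omega

theorem image_slope (hN : W.Nondeg) {R : A} (n : ℕ) : ∀ {U D J : A} (e : U ⟶ J) (m : J ⟶ D),
    Epi e → Mono m → W.SS R U → W.SS R D → (W.rk J).toNat = n → W.br J R = 0 := by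
  induction n using Nat.strong_induction_on with
  | _ n ih =>
  intro U D J e m he hm hU hD hn
  by_cases hz : IsZero J
  · exact W.br_zero_left hz R
  obtain ⟨X, hX, ⟨t, ht⟩, i, x, hx⟩ := W.exists_brick (isBundle_sub m hD.bundle) hz
  obtain ⟨w, hS⟩ := ses_preimage e t
  obtain ⟨h0, hK, -⟩ := hU.brick_par hN hD hS hX i (x ≫ (W.Tf i).map m)
  have a3 := W.add_of_brick_right hN (ses_kernel t) hX
  have h1 := a3.br_left R
  have h2 := a3.1
  dsimp only at h1 h2
  have hX0 := hX.rk_pos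
  have hK0 := W.rk_nonneg (kernel t)
  have h3 := ih _ (by omega) (pullback.snd e (kernel.ι t)) (kernel.ι t ≫ m) inferInstance
    inferInstance hK hD rfl
  omega

/-! ### Factors of a non-exceptional indecomposable bundle -/

/-- `Z` is a quotient of a semistable subobject of `D`. -/
def Fac (R D Z : A) : Prop :=
  ∃ (U : A) (u : U ⟶ D) (z : U ⟶ Z), W.SS R U ∧ Mono u ∧ Epi z

theorem Fac_T {R D Z : A} (h : W.Fac R (W.T 1 D) (W.T 1 Z)) : W.Fac R D Z := by
  obtain ⟨U, u, z, hU, hu, hz⟩ := h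
  obtain ⟨n, hn⟩ := W.T_inv 1
  obtain ⟨⟨e⟩, -⟩ := hn D
  obtain ⟨⟨e'⟩, -⟩ := hn Z
  exact ⟨W.T n U, (W.Tf n).map u ≫ e.hom, (W.Tf n).map z ≫ e'.hom, W.SS_T n hU, inferInstance,
    inferInstance⟩

theorem Fac_quot (hN : W.Nondeg) {R U Y C Z : A} {f : U ⟶ Y} {g : Y ⟶ C}
    {w : f ≫ g = 0} (hS : (ShortComplex.mk f g w).ShortExact) (hU : W.SS R U) (hY : W.SS R Y)
    (h : W.Fac R C Z) : W.Fac R Y Z := by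
  obtain ⟨J, n, z, hJ, hn, hz⟩ := h
  have hg : Epi g := hS.epi_g
  obtain ⟨w1, hP⟩ := ses_pullback hS n
  have h1 := (W.SS_add hN _ hP hU rfl).br_left R
  dsimp only at h1
  refine ⟨pullback g n, pullback.fst g n, pullback.snd g n ≫ z,
    W.SS_sub hY (pullback.fst g n) ?_, inferInstance, epi_comp _ _⟩
  rw [h1, hU.par, hJ.par, add_zero]

theorem hom_zero_of_min (hN : W.Nondeg) {R U Z D : A} (hR : 0 < W.rk R) (hU : W.SS R U)
    (hZ : W.OB Z) (hZR : W.br Z R = 0) (z : U ⟶ Z) [Epi z]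
    (hmin : ∀ (V : A) (a : V ⟶ U) (y : V ⟶ Z), Mono a → Epi y → W.SS R V → W.rk U ≤ W.rk V)
    (hD : W.SS R D) (hF : ¬ W.Fac R D Z) (g : U ⟶ D) : g = 0 := by
  by_contra hg
  have hJ : W.SS R (image g) := W.SS_sub hD (image.ι g)
    (W.image_slope hN _ (factorThruImage g) (image.ι g) inferInstance inferInstance hU hD rfl)
  obtain ⟨X, hX, ⟨t, ht⟩, i, m, hm⟩ := W.exists_brick hJ.bundle (image_not_isZero hg)
  have hS := ses_kernel (factorThruImage g ≫ t)
  obtain ⟨h0, hK, hrk⟩ := hU.brick_par hN hJ hS hX i m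
  have hX0 := hX.rk_pos
  by_cases hk : kernel.ι (factorThruImage g ≫ t) ≫ z = 0
  · have h1 : (factorThruImage g ≫ t) ≫ hS.exact.desc z hk = z := hS.exact.g_desc z hk
    have h2 : Epi (t ≫ hS.exact.desc z hk) := by
      have : Epi (factorThruImage g ≫ t ≫ hS.exact.desc z hk) := by
        rw [← Category.assoc, h1]; infer_instance
      exact epi_of_epi (factorThruImage g) _
    exact hF ⟨image g, image.ι g, t ≫ hS.exact.desc z hk, hJ, inferInstance, h2⟩
  · have h1 := W.image_slope hN _ (factorThruImage (kernel.ι (factorThruImage g ≫ t) ≫ z))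
      (image.ι (kernel.ι (factorThruImage g ≫ t) ≫ z)) inferInstance inferInstance hK
      (W.SS_of_OB hR hZ hZR) rfl
    have h2 : IsIso (image.ι (kernel.ι (factorThruImage g ≫ t) ≫ z)) := by
      by_contra hi
      have h3 := hZ.br_sub _ hi (image_not_isZero hk)
      have h4 := W.br_trans (image (kernel.ι (factorThruImage g ≫ t) ≫ z)) Z R
      rw [h1, hZR, zero_mul, zero_mul, add_zero] at h4
      have := mul_pos h3 hR
      omega
    have h3 : Epi (kernel.ι (factorThruImage g ≫ t) ≫ z) := by
      rw [← image.fac (kernel.ι (factorThruImage g ≫ t) ≫ z)]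
      exact epi_comp _ _
    have h4 := hmin _ (kernel.ι (factorThruImage g ≫ t)) _ inferInstance h3 hK
    omega

theorem Fac_step (hN : W.Nondeg) {E Z : A} (hE : IsBundle E) (hi : Indecomposable E)
    (hne : ¬ Ext1IsZero (A := A) E E) (hZ : W.OB Z) (hZE : W.br Z E = 0)
    (h : W.Fac E E (W.T 1 Z)) : W.Fac E E Z := by
  classical
  by_contra hF
  have hR : 0 < W.rk E := W.rk_pos_of_bundle E hE hi.1
  have hEE := W.SS_of_indec hE hi
  let P : ℕ → Prop := fun n => ∃ (U : A) (u : U ⟶ E) (z : U ⟶ W.T 1 Z), W.SS E U ∧ Mono u ∧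
    Epi z ∧ (W.rk U).toNat = n
  have hP : ∃ n, P n := by
    obtain ⟨U, u, z, h1, h2, h3⟩ := h
    exact ⟨_, U, u, z, h1, h2, h3, rfl⟩
  obtain ⟨U, u, z, hU, hu, hz, hn⟩ := Nat.find_spec hP
  have hmin : ∀ (V : A) (a : V ⟶ U) (y : V ⟶ W.T 1 Z), Mono a → Epi y → W.SS E V →
      W.rk U ≤ W.rk V := by
    intro V a y ha hy hV
    have := Nat.find_min' hP ⟨V, a ≫ u, y, hV, mono_comp _ _, hy, rfl⟩
    have h1 := W.rk_nonneg U
    have h2 := W.rk_nonneg V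
    omega
  have hS := ses_cokernel u
  have hC : W.SS E (cokernel u) := W.SS_quot hN hR hS hU hEE
  have hZ1 := W.OB_T 1 hZ
  have hZ1E : W.br (W.T 1 Z) E = 0 := by rw [W.br_T_left, hZE]
  have k1 : ∀ g : U ⟶ W.T 1 E, g = 0 := W.hom_zero_of_min hN hR hU hZ1 hZ1E z hmin
    (W.SS_T 1 hEE) (fun h => hF (W.Fac_T h))
  have k2 : ∀ g : U ⟶ W.T 1 (cokernel u), g = 0 := W.hom_zero_of_min hN hR hU hZ1 hZ1E z hmin
    (W.SS_T 1 hC) (fun h => hF (W.Fac_quot hN hS hU hEE (W.Fac_T h)))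
  have hext : Ext1IsZero (cokernel u) U := (W.serre _ _).2 k2
  obtain ⟨r, hr⟩ := hext _ _ _ (cokernel.condition u) hS.mono_f hS.epi_g hS.exact
  have sp := ShortComplex.Splitting.ofExactOfRetraction _ hS.exact r hr hS.epi_g
  have hU0 : ¬ IsZero U := fun h0 => ne_zero_of_epi z hZ1.ne (h0.eq_of_src _ _)
  have hC0 : IsZero (cokernel u) := (hi.2 _ _ sp.isoBinaryBiproduct).resolve_left hU0
  have hue : Epi u := Preadditive.epi_of_cokernel_zero (hC0.eq_of_tgt _ _)
  refine hne ((W.serre _ _).2 fun f => ?_)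
  exact zero_of_epi_comp u (k1 (u ≫ f))

theorem exists_factor (hN : W.Nondeg) {E : A} (hE : IsBundle E) (hi : Indecomposable E)
    (hne : ¬ Ext1IsZero (A := A) E E) :
    ∃ Y : A, W.OB Y ∧ W.br Y E = 0 ∧ ∀ j : ℕ, W.Fac E E (W.T j Y) := by
  have hEE := W.SS_of_indec hE hi
  obtain ⟨Y, hY, ⟨q, hq⟩, i, m, hm⟩ := W.exists_brick hE hi.1
  obtain ⟨h0, -, -⟩ := hEE.brick_par hN hEE (ses_kernel q) hY i m
  refine ⟨Y, hY, h0, fun j => ?_⟩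
  have key : ∀ d : ℕ, W.Fac E E (W.T (j + d) Y) → W.Fac E E (W.T j Y) := by
    intro d
    induction d with
    | zero => exact id
    | succ d ih =>
      intro h
      refine ih (W.Fac_step hN hE hi hne (W.OB_T _ hY) (by rw [W.br_T_left, h0]) ?_)
      rw [W.T_T]
      exact h
  refine key (j * W.p - j) ?_
  have hp := W.hp
  have h1 : j + (j * W.p - j) = j * W.p := by
    have : j ≤ j * W.p := Nat.le_mul_of_pos_right j hp
    omega
  rw [h1]
  obtain ⟨e⟩ := W.T_mul_p j Y
  exact ⟨E, 𝟙 E, q ≫ e.inv, hEE, inferInstance, epi_comp _ _⟩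

/-! ### Reduction to indecomposable summands and the main argument -/

theorem indec_summand (hN : W.Nondeg) (G : A) (s : ℤ) (n : ℕ) : ∀ F : A, IsBundle F →
    0 < s * W.br F G → (W.rk F).toNat = n →
    ∃ (F' : A) (i : F' ⟶ F) (r : F ⟶ F'), IsBundle F' ∧ Indecomposable F' ∧ i ≫ r = 𝟙 F' ∧
      0 < s * W.br F' G := by
  induction n using Nat.strong_induction_on with
  | _ n ih =>
  intro F hF hpos hn
  by_cases hi : Indecomposable F
  · exact ⟨F, 𝟙 F, 𝟙 F, hF, hi, by simp, hpos⟩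
  have hF0 : ¬ IsZero F := by
    intro h0
    rw [W.br_zero_left h0, mul_zero] at hpos
    exact lt_irrefl _ hpos
  have hdec : ∃ (U V : A) (_ : F ≅ U ⊞ V), ¬ IsZero U ∧ ¬ IsZero V := by
    by_contra hcon
    push Not at hcon
    refine hi ⟨hF0, fun U V e => ?_⟩
    by_contra h
    push Not at h
    exact h.2 (hcon U V e h.1)
  obtain ⟨U, V, e, hU, hV⟩ := hdec
  have hUb : IsBundle U := isBundle_sub (biprod.inl ≫ e.inv) hF
  have hVb : IsBundle V := isBundle_sub (biprod.inr ≫ e.inv) hF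
  obtain ⟨a1, a2⟩ := W.add_of_split hN U V
  obtain ⟨b1, b2⟩ := W.phi_iso hN e
  have hr1 := W.rk_pos_of_bundle U hUb hU
  have hr2 := W.rk_pos_of_bundle V hVb hV
  have hbr : W.br F G = W.br U G + W.br V G := by
    simp only [br, b1, b2, a1, a2]; ring
  rw [hbr, mul_add] at hpos
  by_cases hs : 0 < s * W.br U G
  · obtain ⟨F', i, r, h1, h2, h3, h4⟩ := ih _ (by omega) U hUb hs rfl
    refine ⟨F', i ≫ biprod.inl ≫ e.inv, e.hom ≫ biprod.fst ≫ r, h1, h2, ?_, h4⟩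
    simp [h3]
  · obtain ⟨F', i, r, h1, h2, h3, h4⟩ := ih _ (by omega) V hVb (by omega) rfl
    refine ⟨F', i ≫ biprod.inr ≫ e.inv, e.hom ≫ biprod.snd ≫ r, h1, h2, ?_, h4⟩
    simp [h3]

theorem case_left (hN : W.Nondeg) {E F : A} (hE : IsBundle E) (hi : Indecomposable E)
    (hne : ¬ Ext1IsZero (A := A) E E) (hF : IsBundle F) (hpos : 0 < W.br E F)
    (hiF : Indecomposable F) : ∃ f : E ⟶ F, f ≠ 0 := by
  by_contra hcon
  push Not at hcon
  have hR : 0 < W.rk E := W.rk_pos_of_bundle E hE hi.1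
  have hR' : 0 < W.rk F := W.rk_pos_of_bundle F hF hiF.1
  have hEE := W.SS_of_indec hE hi
  have hFF := W.SS_of_indec hF hiF
  obtain ⟨Y, hY, h0, hfac⟩ := W.exists_factor hN hE hi hne
  have horth : W.Orth Y F := by
    rw [W.orth_iff]
    intro j f
    obtain ⟨U, u, z, hU, hu, hz⟩ := hfac j
    have hS := ses_cokernel u
    have hC : W.SS E (cokernel u) := W.SS_quot hN hR hS hU hEE
    have hext : Ext1IsZero (cokernel u) F := (W.serre _ _).2
      (W.hom_SS_eq_zero hN hR' hR hpos hFF (W.SS_T 1 hC))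
    obtain ⟨g, hg⟩ := extend_of_ext hS hext (z ≫ f)
    rw [hcon g, comp_zero] at hg
    exact zero_of_epi_comp z hg.symm
  have h1 := W.RR Y F
  rw [W.ah_eq_zero horth] at h1
  have h2 := W.br_trans Y E F
  rw [h0, zero_mul, zero_add] at h2
  have h3 := hY.rk_pos
  have h4 := mul_pos hpos h3
  have h5 : 0 < W.br Y F := by
    rw [← h2] at h4
    exact (mul_pos_iff_of_pos_right hR).1 h4
  omega

theorem case_right (hN : W.Nondeg) {E F : A} (hF : IsBundle F) (hi : Indecomposable F)
    (hne : ¬ Ext1IsZero (A := A) F F) (hE : IsBundle E) (hpos : 0 < W.br E F)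
    (hiE : Indecomposable E) : ∃ f : E ⟶ F, f ≠ 0 := by
  by_contra hcon
  push Not at hcon
  have hR : 0 < W.rk F := W.rk_pos_of_bundle F hF hi.1
  have hR' : 0 < W.rk E := W.rk_pos_of_bundle E hE hiE.1
  have hEE := W.SS_of_indec hE hiE
  obtain ⟨Y, hY, h0, hfac⟩ := W.exists_factor hN hF hi hne
  have horth : W.Orth E Y := by
    intro j f
    obtain ⟨U, u, z, hU, hu, hz⟩ := hfac j
    have hS := ses_kernel z
    have h0' : W.br (W.T j Y) F = 0 := by rw [W.br_T_left, h0]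
    have hYj := W.OB_T j hY
    have hid : Mono (show W.T j Y ⟶ W.T 0 (W.T j Y) from 𝟙 (W.T j Y)) :=
      inferInstanceAs (Mono (𝟙 (W.T j Y)))
    have hK : W.SS F (kernel z) := (hU.brick_par hN (W.SS_of_OB hR hYj h0') hS hYj 0
      (show W.T j Y ⟶ W.T 0 (W.T j Y) from 𝟙 (W.T j Y))).2.1
    have hext : Ext1IsZero E (kernel z) := (W.serre _ _).2
      (W.hom_SS_eq_zero hN hR hR' hpos hK (W.SS_T 1 hEE))
    obtain ⟨g, hg⟩ := lift_of_ext hS hext f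
    have hg0 : g = 0 := zero_of_comp_mono u (hcon (g ≫ u))
    rw [hg0, zero_comp] at hg
    exact hg.symm
  have h1 := W.RR E Y
  rw [W.ah_eq_zero horth] at h1
  have h2 := W.br_trans E Y F
  rw [h0, zero_mul, add_zero] at h2
  have h3 := hY.rk_pos
  have h4 := mul_pos hpos h3
  have h5 : 0 < W.br E Y := by
    rw [h2] at h4
    exact (mul_pos_iff_of_pos_right hR).1 h4
  omega

theorem main_aux (E F : A) (hE : IsBundle E) (hF : IsBundle F) (hpos : 0 < W.br E F) :
    (∃ (i : ℤ) (f : E ⟶ (epow W.tau i).obj F), f ≠ 0) ∧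
    (((Indecomposable E ∧ ¬ Ext1IsZero (A := A) E E) ∨
      (Indecomposable F ∧ ¬ Ext1IsZero (A := A) F F)) →
        ∃ f : E ⟶ F, f ≠ 0) := by
  have hN : W.Nondeg := ⟨E, F, hpos.ne'⟩
  constructor
  · have h : ¬ W.Orth E F := by
      intro h
      have h1 := W.RR E F
      rw [W.ah_eq_zero h] at h1
      omega
    unfold Orth at h
    push Not at h
    obtain ⟨i, f, hf⟩ := h
    have he : epow W.tau (i : ℤ) = W.Tf i := by
      unfold epow
      rw [if_pos (Int.natCast_nonneg i), Int.toNat_natCast]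
      rfl
    refine ⟨(i : ℤ), ?_⟩
    rw [he]
    exact ⟨f, hf⟩
  · rintro (⟨hi, hne⟩ | ⟨hi, hne⟩)
    · obtain ⟨F', i, r, h1, h2, h3, h4⟩ := W.indec_summand hN E (-1) _ F hF
        (by rw [W.br_symm F E]; linarith) rfl
      obtain ⟨f, hf⟩ := W.case_left hN hE hi hne h1 (by rw [W.br_symm]; linarith) h2
      have : Mono i := mono_of_mono_fac h3
      exact ⟨f ≫ i, fun h => hf (zero_of_comp_mono i h)⟩
    · obtain ⟨E', i, r, h1, h2, h3, h4⟩ := W.indec_summand hN F 1 _ E hE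
        (by linarith) rfl
      obtain ⟨f, hf⟩ := W.case_right hN hF hi hne h1 (by linarith) h2
      have : Epi r := epi_of_epi_fac h3
      exact ⟨r ≫ f, fun h => hf (zero_of_epi_comp r h)⟩

end TubularWPLData

end Helpers

/-- Let `X` be a weighted projective line of tubular type and `E`, `F` nonzero vector
bundles with `μ(E) < μ(F)`.  Then `Hom(E, τⁱF) ≠ 0` for some `i ∈ ℤ`.  If moreover `E` or
`F` is a non-exceptional indecomposable bundle, then `Hom(E, F) ≠ 0`. -/
theorem tubular_bundle_hom
    (W : TubularWPLData k A) (E F : A)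
    (hE : IsBundle E) (hE0 : ¬ IsZero E)
    (hF : IsBundle F) (hF0 : ¬ IsZero F)
    (hslope : W.deg E * W.rk F < W.deg F * W.rk E) :
    (∃ (i : ℤ) (f : E ⟶ (epow W.tau i).obj F), f ≠ 0) ∧
    (((Indecomposable E ∧ ¬ Ext1IsZero (A := A) E E) ∨
      (Indecomposable F ∧ ¬ Ext1IsZero (A := A) F F)) →
        ∃ f : E ⟶ F, f ≠ 0) := by
  exact W.main_aux E F hE hF (by rw [TubularWPLData.br]; linarith)
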